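/- arXiv:1512.02863 — 2 statements merged into one kernel-verified Lean document; each statement's English description precedes it below -/
import Mathlib

section
/- Let n ≥ 1, let p_1, ..., p_n > 0, q_1, ..., q_n > 0 and 0 < r < p_1 + ... + p_n. Let S = { x ∈ R^n : x_k ≥ 0 for all k, Σ_k x_k ≤ 1 }. Then ∫_S (∏_{k=1}^n x_k^{p_k − 1}) / (Σ_{k=1}^n q_k x_k)^r dx = ( Γ(p_1)···Γ(p_n) / ( Γ(Σ_k p_k − r + 1) Γ(r) ) ) ∫_0^∞ x^{r−1} / ∏_{k=1}^n (1 + q_k x)^{p_k} dx. -/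
open MeasureTheory Real

lemma aux_gamma {a b : ℝ} (ha : 0 < a) (hb : 0 < b) :
    IntegrableOn (fun t : ℝ => t ^ (a - 1) * exp (-(b * t))) (Set.Ioi 0) := by
  by_contra h
  have h1 := integral_undef h
  rw [integral_rpow_mul_exp_neg_mul_Ioi ha hb] at h1
  have h2 : 0 < (1 / b) ^ a * Real.Gamma a := mul_pos (by positivity) (Real.Gamma_pos_of_pos ha)
  exact h2.ne' h1

lemma aux_lgamma {a b : ℝ} (ha : 0 < a) (hb : 0 < b) :
    ∫⁻ t in Set.Ioi (0:ℝ), ENNReal.ofReal (t ^ (a - 1) * exp (-(b * t)))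
      = ENNReal.ofReal ((1 / b) ^ a * Real.Gamma a) := by
  rw [← integral_rpow_mul_exp_neg_mul_Ioi ha hb, ofReal_integral_eq_lintegral_ofReal (aux_gamma ha hb)]
  filter_upwards [ae_restrict_mem measurableSet_Ioi] with t ht
  have : (0:ℝ) < t := ht
  simp only [Pi.zero_apply]
  positivity

lemma aux_lexp {s : ℝ} (hs : 0 < s) :
    ∫⁻ t in Set.Ioi (0:ℝ), (Set.Ici s).indicator (fun t => ENNReal.ofReal (exp (-t))) t
      = ENNReal.ofReal (exp (-s)) := by
  rw [lintegral_indicator measurableSet_Ici, Measure.restrict_restrict measurableSet_Ici,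
    Set.inter_eq_left.2 (Set.Ici_subset_Ioi.2 hs),
    ← setLIntegral_congr Ioi_ae_eq_Ici, ← integral_exp_neg_Ioi,
    ofReal_integral_eq_lintegral_ofReal]
  · exact integrableOn_exp_neg_Ioi s
  · exact Filter.Eventually.of_forall fun t => (exp_pos _).le

/-- the integrand -/
noncomputable def auxF {n : ℕ} (p q : Fin n → ℝ) (r : ℝ) (x : Fin n → ℝ) : ℝ :=
  (∏ k, x k ^ (p k - 1)) / (∑ k, q k * x k) ^ r

lemma auxF_meas {n : ℕ} (p q : Fin n → ℝ) (r : ℝ) : Measurable (auxF p q r) := by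
  unfold auxF; fun_prop

def auxO (n : ℕ) : Set (Fin n → ℝ) := Set.pi Set.univ fun _ => Set.Ioi 0

lemma auxO_meas (n : ℕ) : MeasurableSet (auxO n) :=
  MeasurableSet.univ_pi fun _ => measurableSet_Ioi

def auxS (n : ℕ) (t : ℝ) : Set (Fin n → ℝ) := {x | ∑ k, x k ≤ t}

lemma auxS_meas (n : ℕ) (t : ℝ) : MeasurableSet (auxS n t) :=
  measurableSet_le (by fun_prop) measurable_const

lemma auxF_smul {n : ℕ} (p q : Fin n → ℝ) (hq : ∀ k, 0 < q k) (r : ℝ) {t : ℝ} (ht : 0 < t)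
    (x : Fin n → ℝ) (hx : x ∈ auxO n) :
    auxF p q r (t • x) = (t ^ n)⁻¹ * t ^ ((∑ k, p k) - r) * auxF p q r x := by
  have hx' : ∀ k, 0 < x k := fun k => hx k trivial
  have hs : 0 ≤ ∑ k, q k * x k := Finset.sum_nonneg fun k _ => (mul_pos (hq k) (hx' k)).le
  unfold auxF
  have h1 : ∏ k, (t • x) k ^ (p k - 1) = (t ^ n)⁻¹ * t ^ (∑ k, p k) * ∏ k, x k ^ (p k - 1) := by
    simp only [Pi.smul_apply, smul_eq_mul]
    rw [Finset.prod_congr rfl fun k _ => mul_rpow ht.le (hx' k).le, Finset.prod_mul_distrib,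
      ← rpow_sum_of_pos ht, Finset.sum_sub_distrib, rpow_sub ht]
    simp only [Finset.sum_const, Finset.card_univ, Fintype.card_fin, nsmul_eq_mul, mul_one,
      rpow_natCast]
    ring
  have h2 : ∑ k, q k * (t • x) k = t * ∑ k, q k * x k := by
    rw [Finset.mul_sum]; exact Finset.sum_congr rfl fun k _ => by simp; ring
  rw [h1, h2, mul_rpow ht.le hs, rpow_sub ht]
  ring

lemma aux_scale {n : ℕ} (p q : Fin n → ℝ) (hq : ∀ k, 0 < q k) (r : ℝ) {t : ℝ} (ht : 0 < t) :
    ∫⁻ x in auxS n t ∩ auxO n, ENNReal.ofReal (auxF p q r x) =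
      ENNReal.ofReal (t ^ ((∑ k, p k) - r)) *
        ∫⁻ x in auxS n 1 ∩ auxO n, ENNReal.ofReal (auxF p q r x) := by
  have hF := auxF_meas p q r
  have hm : ∀ t, MeasurableSet (auxS n t ∩ auxO n) := fun t => (auxS_meas n t).inter (auxO_meas n)
  rw [← lintegral_indicator (hm _), ← lintegral_indicator (hm _)]
  set h := (auxS n t ∩ auxO n).indicator fun x => ENNReal.ofReal (auxF p q r x) with hh
  have hmeas : Measurable h := hF.ennreal_ofReal.indicator (hm t)
  have e1 : ∫⁻ x, h (t • x) = ENNReal.ofReal ((t ^ n)⁻¹) * ∫⁻ x, h x := by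
    rw [← lintegral_map hmeas (measurable_const_smul t), Measure.map_addHaar_smul _ ht.ne',
      lintegral_smul_measure]
    simp [abs_of_pos ht]
  have e2 : ∀ x, h (t • x) = ENNReal.ofReal ((t ^ n)⁻¹) * (ENNReal.ofReal (t ^ ((∑ k, p k) - r)) *
      (auxS n 1 ∩ auxO n).indicator (fun x => ENNReal.ofReal (auxF p q r x)) x) := by
    intro x
    have hiff : t • x ∈ auxS n t ∩ auxO n ↔ x ∈ auxS n 1 ∩ auxO n := by
      simp only [auxS, auxO, Set.mem_inter_iff, Set.mem_ofPred_eq, Set.mem_pi, Set.mem_univ,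
        forall_true_left, Set.mem_Ioi, Pi.smul_apply, smul_eq_mul, ← Finset.mul_sum]
      simp [ht]
    by_cases hx : x ∈ auxS n 1 ∩ auxO n
    · rw [hh, Set.indicator_of_mem (hiff.2 hx), Set.indicator_of_mem hx,
        auxF_smul p q hq r ht x hx.2, ENNReal.ofReal_mul (by positivity),
        ENNReal.ofReal_mul (by positivity), mul_assoc]
    · rw [hh, Set.indicator_of_notMem (fun h => hx (hiff.1 h)), Set.indicator_of_notMem hx]
      simp
  simp_rw [e2] at e1
  rw [lintegral_const_mul _ (by exact (hF.ennreal_ofReal.indicator (hm 1)).const_mul _),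
    lintegral_const_mul _ (hF.ennreal_ofReal.indicator (hm 1))] at e1
  have hc : ENNReal.ofReal ((t ^ n)⁻¹) ≠ 0 := by simp; positivity
  exact ((ENNReal.mul_right_inj hc ENNReal.ofReal_ne_top).1 e1).symm

lemma aux_A {n : ℕ} (hn : 1 ≤ n) (p q : Fin n → ℝ) (hq : ∀ k, 0 < q k)
    (r : ℝ) (hr : r < ∑ k, p k) :
    ∫⁻ x in auxO n, ENNReal.ofReal (auxF p q r x) * ENNReal.ofReal (exp (-∑ k, x k)) =
      ENNReal.ofReal (Real.Gamma ((∑ k, p k) - r + 1)) *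
        ∫⁻ x in auxS n 1 ∩ auxO n, ENNReal.ofReal (auxF p q r x) := by
  have hF := auxF_meas p q r
  have : Nonempty (Fin n) := ⟨⟨0, hn⟩⟩
  have hE : MeasurableSet {z : (Fin n → ℝ) × ℝ | ∑ k, z.1 k ≤ z.2} :=
    measurableSet_le (by fun_prop) (by fun_prop)
  calc _ = ∫⁻ x in auxO n, ∫⁻ t in Set.Ioi (0:ℝ), ENNReal.ofReal (auxF p q r x) *
        {z : (Fin n → ℝ) × ℝ | ∑ k, z.1 k ≤ z.2}.indicator
          (fun z => ENNReal.ofReal (exp (-z.2))) (x, t) := by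
        refine setLIntegral_congr_fun (auxO_meas n) fun x hx => ?_
        have hs : 0 < ∑ k, x k := Finset.sum_pos (fun k _ => hx k trivial) Finset.univ_nonempty
        rw [lintegral_const_mul' _ _ ENNReal.ofReal_ne_top, ← aux_lexp hs]
        rfl
    _ = ∫⁻ t in Set.Ioi (0:ℝ), ∫⁻ x in auxO n, ENNReal.ofReal (auxF p q r x) *
        {z : (Fin n → ℝ) × ℝ | ∑ k, z.1 k ≤ z.2}.indicator
          (fun z => ENNReal.ofReal (exp (-z.2))) (x, t) := by
        apply lintegral_lintegral_swap
        apply Measurable.aemeasurable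
        exact (hF.comp measurable_fst).ennreal_ofReal.mul
          (Measurable.indicator (by fun_prop) hE)
    _ = ∫⁻ t in Set.Ioi (0:ℝ), ENNReal.ofReal (t ^ (((∑ k, p k) - r + 1) - 1) * exp (-(1 * t))) *
        ∫⁻ x in auxS n 1 ∩ auxO n, ENNReal.ofReal (auxF p q r x) := by
        refine setLIntegral_congr_fun measurableSet_Ioi fun t ht => ?_
        have ht' : (0:ℝ) < t := ht
        rw [add_sub_cancel_right, mul_comm (t ^ _), ENNReal.ofReal_mul (exp_pos _).le, mul_assoc,
          ← aux_scale p q hq r ht', ← Measure.restrict_restrict (auxS_meas n t),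
          ← lintegral_indicator (auxS_meas n t),
          ← lintegral_const_mul' _ _ ENNReal.ofReal_ne_top]
        refine lintegral_congr fun x => ?_
        by_cases hx : ∑ k, x k ≤ t
        · rw [Set.indicator_of_mem (by exact hx), Set.indicator_of_mem (by exact hx), mul_comm,
            one_mul]
        · rw [Set.indicator_of_notMem (by exact hx), Set.indicator_of_notMem (by exact hx)]
          simp
    _ = _ := by
        rw [lintegral_mul_const _ (by fun_prop), aux_lgamma (by linarith) one_pos]
        simp

lemma aux_prod {n : ℕ} (p q : Fin n → ℝ) (hp : ∀ k, 0 < p k) (hq : ∀ k, 0 < q k)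
    {y : ℝ} (hy : 0 < y) :
    ∫⁻ x in auxO n, ENNReal.ofReal (∏ k, (x k ^ (p k - 1) * exp (-((1 + q k * y) * x k)))) =
      ENNReal.ofReal ((∏ k, Real.Gamma (p k)) / ∏ k, (1 + q k * y) ^ (p k)) := by
  have hb : ∀ k, 0 < 1 + q k * y := fun k => by have := hq k; positivity
  have hI : ∫ x in auxO n, (∏ k, (x k ^ (p k - 1) * exp (-((1 + q k * y) * x k)))) =
      (∏ k, Real.Gamma (p k)) / ∏ k, (1 + q k * y) ^ (p k) := by
    rw [auxO, volume_pi, Measure.restrict_pi_pi]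
    rw [integral_fintype_prod_eq_prod
      (f := fun k t => t ^ (p k - 1) * exp (-((1 + q k * y) * t)))]
    rw [← Finset.prod_div_distrib]
    refine Finset.prod_congr rfl fun k _ => ?_
    rw [integral_rpow_mul_exp_neg_mul_Ioi (hp k) (hb k), one_div, inv_rpow (hb k).le]
    field_simp
  rw [← hI, ofReal_integral_eq_lintegral_ofReal]
  · rw [auxO, volume_pi, Measure.restrict_pi_pi]
    exact Integrable.fintype_prod
      (f := fun k t => t ^ (p k - 1) * exp (-((1 + q k * y) * t)))
      (fun k => aux_gamma (hp k) (hb k))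
  · filter_upwards [ae_restrict_mem (auxO_meas n)] with x hx
    exact Finset.prod_nonneg fun k _ => mul_nonneg (rpow_nonneg (le_of_lt (hx k trivial)) _)
      (exp_pos _).le

lemma aux_B {n : ℕ} (hn : 1 ≤ n) (p q : Fin n → ℝ) (hp : ∀ k, 0 < p k) (hq : ∀ k, 0 < q k)
    (r : ℝ) (hr0 : 0 < r) :
    ENNReal.ofReal (Real.Gamma r) *
    ∫⁻ x in auxO n, ENNReal.ofReal (auxF p q r x) * ENNReal.ofReal (exp (-∑ k, x k)) =
      ENNReal.ofReal (∏ k, Real.Gamma (p k)) *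
        ∫⁻ y in Set.Ioi (0:ℝ), ENNReal.ofReal (y ^ (r - 1) / ∏ k, (1 + q k * y) ^ (p k)) := by
  have : Nonempty (Fin n) := ⟨⟨0, hn⟩⟩
  have hG : 0 ≤ ∏ k, Real.Gamma (p k) :=
    Finset.prod_nonneg fun k _ => (Real.Gamma_pos_of_pos (hp k)).le
  rw [← lintegral_const_mul' _ _ ENNReal.ofReal_ne_top,
    ← lintegral_const_mul' _ _ ENNReal.ofReal_ne_top]
  calc _ = ∫⁻ x in auxO n, ∫⁻ y in Set.Ioi (0:ℝ), ENNReal.ofReal (y ^ (r - 1)) *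
        ENNReal.ofReal (∏ k, (x k ^ (p k - 1) * exp (-((1 + q k * y) * x k)))) := by
        refine setLIntegral_congr_fun (auxO_meas n) fun x hx => ?_
        have hx' : ∀ k, 0 < x k := fun k => hx k trivial
        have hs : 0 < ∑ k, q k * x k :=
          Finset.sum_pos (fun k _ => mul_pos (hq k) (hx' k)) Finset.univ_nonempty
        have hP : 0 ≤ ∏ k, x k ^ (p k - 1) :=
          Finset.prod_nonneg fun k _ => rpow_nonneg (hx' k).le _
        have hG : 0 ≤ Real.Gamma r := (Real.Gamma_pos_of_pos hr0).le
        have hFn : 0 ≤ auxF p q r x := div_nonneg hP (rpow_nonneg hs.le _)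
        trans ∫⁻ y in Set.Ioi (0:ℝ), ENNReal.ofReal ((∏ k, x k ^ (p k - 1)) * exp (-∑ k, x k)) *
          ENNReal.ofReal (y ^ (r - 1) * exp (-((∑ k, q k * x k) * y)))
        · rw [lintegral_const_mul' _ _ ENNReal.ofReal_ne_top, aux_lgamma hr0 hs,
            ← ENNReal.ofReal_mul hFn, ← ENNReal.ofReal_mul hG,
            ← ENNReal.ofReal_mul (by positivity), auxF, one_div, inv_rpow hs.le]
          congr 1
          ring
        · refine setLIntegral_congr_fun measurableSet_Ioi fun y hy => ?_
          have hy' : (0:ℝ) < y := hy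
          rw [← ENNReal.ofReal_mul (by positivity), ← ENNReal.ofReal_mul (by positivity),
            Finset.prod_mul_distrib, ← exp_sum]
          have : ∑ k, -((1 + q k * y) * x k) = -∑ k, x k + -((∑ k, q k * x k) * y) := by
            rw [Finset.sum_mul, ← Finset.sum_neg_distrib, ← Finset.sum_neg_distrib,
              ← Finset.sum_add_distrib]
            exact Finset.sum_congr rfl fun k _ => by ring
          rw [this, exp_add]
          congr 1
          ring
    _ = ∫⁻ y in Set.Ioi (0:ℝ), ∫⁻ x in auxO n, ENNReal.ofReal (y ^ (r - 1)) *
        ENNReal.ofReal (∏ k, (x k ^ (p k - 1) * exp (-((1 + q k * y) * x k)))) := by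
        apply lintegral_lintegral_swap
        apply Measurable.aemeasurable
        unfold Function.uncurry
        fun_prop
    _ = _ := by
        refine setLIntegral_congr_fun measurableSet_Ioi fun y hy => ?_
        have hy' : (0:ℝ) < y := hy
        rw [lintegral_const_mul' _ _ ENNReal.ofReal_ne_top, aux_prod p q hp hq hy',
          ← ENNReal.ofReal_mul (by positivity), ← ENNReal.ofReal_mul hG]
        congr 1
        ring

theorem simplex_integral_formula (n : ℕ) (hn : 1 ≤ n)
    (p q : Fin n → ℝ) (hp : ∀ k, 0 < p k) (hq : ∀ k, 0 < q k)
    (r : ℝ) (hr0 : 0 < r) (hr : r < ∑ k, p k) :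
    (∫ x in {x : Fin n → ℝ | (∀ k, 0 ≤ x k) ∧ ∑ k, x k ≤ 1},
        (∏ k, x k ^ (p k - 1)) / (∑ k, q k * x k) ^ r) =
      (∏ k, Real.Gamma (p k)) / (Real.Gamma ((∑ k, p k) - r + 1) * Real.Gamma r) *
        ∫ x in Set.Ioi (0 : ℝ), x ^ (r - 1) / ∏ k, (1 + q k * x) ^ (p k) := by
  have hset : {x : Fin n → ℝ | (∀ k, 0 ≤ x k) ∧ ∑ k, x k ≤ 1} =
      auxS n 1 ∩ Set.Ici (fun _ => 0) := by
    ext x; simp [auxS, and_comm, Pi.le_def]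
  have hae : (auxS n 1 ∩ Set.Ici (fun _ => 0) : Set (Fin n → ℝ)) =ᵐ[volume]
      (auxS n 1 ∩ auxO n : Set (Fin n → ℝ)) :=
    (Filter.EventuallyEq.refl _ _).inter Measure.univ_pi_Ioi_ae_eq_Ici.symm
  rw [hset, setIntegral_congr_set hae]
  have hm : MeasurableSet (auxS n 1 ∩ auxO n) := (auxS_meas n 1).inter (auxO_meas n)
  have e1 : ∫ x in auxS n 1 ∩ auxO n, (∏ k, x k ^ (p k - 1)) / (∑ k, q k * x k) ^ r =
      (∫⁻ x in auxS n 1 ∩ auxO n, ENNReal.ofReal (auxF p q r x)).toReal := by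
    rw [integral_eq_lintegral_of_nonneg_ae]
    · rfl
    · filter_upwards [ae_restrict_mem hm] with x hx
      have hx' : ∀ k, 0 < x k := fun k => hx.2 k trivial
      exact div_nonneg (Finset.prod_nonneg fun k _ => rpow_nonneg (hx' k).le _)
        (rpow_nonneg (Finset.sum_nonneg fun k _ => (mul_pos (hq k) (hx' k)).le) _)
    · exact (auxF_meas p q r).aestronglyMeasurable
  have e2 : ∫ x in Set.Ioi (0 : ℝ), x ^ (r - 1) / ∏ k, (1 + q k * x) ^ (p k) =
      (∫⁻ y in Set.Ioi (0:ℝ), ENNReal.ofReal (y ^ (r - 1) / ∏ k, (1 + q k * y) ^ (p k))).toReal := by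
    rw [integral_eq_lintegral_of_nonneg_ae]
    · filter_upwards [ae_restrict_mem measurableSet_Ioi] with x hx
      have hx' : (0:ℝ) < x := hx
      exact div_nonneg (rpow_nonneg hx'.le _) (Finset.prod_nonneg fun k _ => rpow_nonneg
        (by have := hq k; positivity) _)
    · exact Measurable.aestronglyMeasurable (by fun_prop)
  have h := aux_B hn p q hp hq r hr0
  rw [aux_A hn p q hq r hr] at h
  have h' := congrArg ENNReal.toReal h
  have g1 : 0 < Real.Gamma r := Real.Gamma_pos_of_pos hr0
  have g2 : 0 < Real.Gamma ((∑ k, p k) - r + 1) := Real.Gamma_pos_of_pos (by linarith)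
  have g3 : 0 ≤ ∏ k, Real.Gamma (p k) :=
    Finset.prod_nonneg fun k _ => (Real.Gamma_pos_of_pos (hp k)).le
  simp only [ENNReal.toReal_mul, ENNReal.toReal_ofReal g1.le, ENNReal.toReal_ofReal g2.le,
    ENNReal.toReal_ofReal g3] at h'
  rw [e1, e2, div_mul_eq_mul_div, eq_div_iff (by positivity), ← h']
  ring
end

section
/- Let Y = (Y_1, Y_2) be standard Gaussian in R² and λ_1 ≥ λ_2 > 0. Then E[λ_1 Y_1² / (λ_1 Y_1² + λ_2 Y_2²)] = √λ_1 / (√λ_1 + √λ_2). -/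
open MeasureTheory ProbabilityTheory Real

/-- The law of a vector of `p` i.i.d. standard normal random variables. -/
noncomputable def stdGaussianPi (p : ℕ) : Measure (Fin p → ℝ) :=
  Measure.pi fun _ => gaussianReal 0 1

/-- The `i`-th eigenvalue of the spatial sign covariance matrix corresponding to
shape eigenvalues `lam`. -/
noncomputable def sscmEigen (p : ℕ) (lam : Fin p → ℝ) (i : Fin p) : ℝ :=
  ∫ ω, lam i * (ω i) ^ 2 / (∑ j, lam j * (ω j) ^ 2) ∂(stdGaussianPi p)

lemma gauss_polar (g : ℝ × ℝ → ℝ)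
    (hg : ∀ r : ℝ, 0 < r → ∀ x y, g (r * x, r * y) = g (x, y)) :
    ∫ p, g p ∂((gaussianReal 0 1).prod (gaussianReal 0 1)) =
      (∫ r in Set.Ioi (0:ℝ), r * ((√(2 * π))⁻¹ ^ 2 * rexp (-r ^ 2 / 2))) *
        ∫ t in Set.Ioo (-π) π, g (cos t, sin t) := by
  rw [gaussianReal_of_var_ne_zero _ one_ne_zero,
    prod_withDensity (measurable_gaussianPDF _ _) (measurable_gaussianPDF _ _),
    integral_withDensity_eq_integral_toReal_smul
      (by have := measurable_gaussianPDF 0 1; fun_prop)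
      (Filter.Eventually.of_forall fun x => ENNReal.mul_lt_top gaussianPDF_lt_top
        gaussianPDF_lt_top)]
  rw [← Measure.volume_eq_prod, ← integral_comp_polarCoord_symm, polarCoord_target,
    ← setIntegral_prod_mul, ← Measure.volume_eq_prod]
  refine setIntegral_congr_fun (measurableSet_Ioi.prod measurableSet_Ioo) ?_
  rintro ⟨r, t⟩ ⟨hr, -⟩
  have hr' : 0 < r := hr
  simp only [polarCoord_symm_apply, hg r hr', ENNReal.toReal_mul, toReal_gaussianPDF,
    gaussianPDFReal, smul_eq_mul, NNReal.coe_one, mul_one, sub_zero]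
  have : rexp (-r ^ 2 / 2) = rexp (-(r * cos t) ^ 2 / 2) * rexp (-(r * sin t) ^ 2 / 2) := by
    rw [← Real.exp_add]
    congr 1
    linear_combination (r ^ 2 / 2) * (cos_sq_add_sin_sq t)
  rw [this]
  ring

lemma gauss_polar' (g : ℝ × ℝ → ℝ)
    (hg : ∀ r : ℝ, 0 < r → ∀ x y, g (r * x, r * y) = g (x, y)) :
    ∫ p, g p ∂((gaussianReal 0 1).prod (gaussianReal 0 1)) =
      (2 * π)⁻¹ * ∫ t in (-π)..π, g (cos t, sin t) := by
  have h1 := gauss_polar (fun _ => 1) (fun _ _ _ _ => rfl)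
  rw [gauss_polar g hg, intervalIntegral.integral_of_le (by linarith [pi_pos]),
    integral_Ioc_eq_integral_Ioo]
  congr 1
  have h2 : ∫ t in Set.Ioo (-π) π, (1:ℝ) = 2 * π := by
    rw [← integral_Ioc_eq_integral_Ioo,
      ← intervalIntegral.integral_of_le (by linarith [pi_pos])]
    simp; ring
  rw [h2] at h1
  simp only [integral_const, probReal_univ, smul_eq_mul, mul_one] at h1
  exact eq_inv_of_mul_eq_one_left h1.symm

lemma angular (a b : ℝ) (ha : 0 < a) (hb : 0 < b) :
    ∫ t in (-π)..π, a ^ 2 * cos t ^ 2 / (a ^ 2 * cos t ^ 2 + b ^ 2 * sin t ^ 2) =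
      2 * π * (a / (a + b)) := by
  have hD : ∀ t, 0 < a ^ 2 * cos t ^ 2 + b ^ 2 * sin t ^ 2 := fun t => by
    by_cases h : cos t = 0
    · have := cos_sq_add_sin_sq t
      rw [h] at this ⊢
      have h3 : sin t ^ 2 = 1 := by linarith
      rw [h3]; positivity
    · positivity
  have hM : ∀ t, 0 < a * cos t ^ 2 + b * sin t ^ 2 := fun t => by
    by_cases h : cos t = 0
    · have := cos_sq_add_sin_sq t
      rw [h] at this ⊢
      have h3 : sin t ^ 2 = 1 := by linarith
      rw [h3]; positivity
    · positivity
  by_cases hab : a = b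
  · subst hab
    have : ∀ t, a ^ 2 * cos t ^ 2 / (a ^ 2 * cos t ^ 2 + a ^ 2 * sin t ^ 2) = cos t ^ 2 := by
      intro t
      rw [← mul_add, cos_sq_add_sin_sq]
      field_simp
    simp_rw [this]
    rw [integral_cos_sq]
    simp
    field_simp
    ring
  have hab' : a - b ≠ 0 := sub_ne_zero.2 hab
  have hder : ∀ t ∈ Set.uIcc (-π) π, HasDerivAt
      (fun t => a / (a + b) * t - a * b / ((a - b) * (a + b)) *
        arctan ((b - a) * (sin t * cos t) / (a * cos t ^ 2 + b * sin t ^ 2)))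
      (a ^ 2 * cos t ^ 2 / (a ^ 2 * cos t ^ 2 + b ^ 2 * sin t ^ 2)) t := by
    intro t _
    have hs := hasDerivAt_sin t
    have hc := hasDerivAt_cos t
    have h1 := ((hs.mul hc).const_mul (b - a)).div
      (((hc.pow 2).const_mul a).add ((hs.pow 2).const_mul b)) (hM t).ne'
    have h2 := ((hasDerivAt_id t).const_mul (a / (a + b))).sub
      (h1.arctan.const_mul (a * b / ((a - b) * (a + b))))
    refine h2.congr_deriv ?_
    have hD' := hD t
    have hM' := hM t
    have e := cos_sq_add_sin_sq t
    simp only [Pi.add_apply, Pi.mul_apply, Pi.pow_apply, Pi.div_apply]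
    generalize cos t = c at *
    generalize sin t = s at *
    have key : 1 + ((b - a) * (s * c) / (a * c ^ 2 + b * s ^ 2)) ^ 2 =
        (a ^ 2 * c ^ 2 + b ^ 2 * s ^ 2) / (a * c ^ 2 + b * s ^ 2) ^ 2 := by
      field_simp
      linear_combination (a ^ 2 * c ^ 2 + b ^ 2 * s ^ 2) * e
    rw [key]
    have hs2 : s ^ 2 = 1 - c ^ 2 := by linarith
    have hp : a + b ≠ 0 := by positivity
    field_simp
    push_cast
    grind
  rw [intervalIntegral.integral_eq_sub_of_hasDerivAt hder]
  · simp
    ring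
  · apply Continuous.intervalIntegrable
    exact Continuous.div (by fun_prop) (by fun_prop) (fun t => (hD t).ne')

theorem sscmEigen_dim_two (l1 l2 : ℝ) (h12 : l2 ≤ l1) (h2 : 0 < l2) :
    (∫ ω : Fin 2 → ℝ,
        l1 * (ω 0) ^ 2 / (l1 * (ω 0) ^ 2 + l2 * (ω 1) ^ 2) ∂(stdGaussianPi 2)) =
      Real.sqrt l1 / (Real.sqrt l1 + Real.sqrt l2) := by
  have h1 : 0 < l1 := h2.trans_le h12
  have hp := (measurePreserving_finTwoArrow (gaussianReal 0 1)).integral_comp'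
    (fun p : ℝ × ℝ => l1 * p.1 ^ 2 / (l1 * p.1 ^ 2 + l2 * p.2 ^ 2))
  have hang := angular (√l1) (√l2) (by positivity) (by positivity)
  rw [sq_sqrt h1.le, sq_sqrt h2.le] at hang
  refine hp.trans ?_
  rw [gauss_polar']
  · simp only
    rw [hang]
    field_simp
  · intro r hr x y
    simp only
    rw [← mul_div_mul_left (l1 * x ^ 2) _ (pow_ne_zero 2 hr.ne')]
    congr 1 <;> ring
end
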